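/- Let ν = a + b√3 ∈ O_K be totally positive and let v := v_{𝔭₂}((ν)). Then ν is a sum of two squares in O_K if and only if: (a) v is even; (b) v_{𝔮}((ν)) is even for every negative prime ideal 𝔮 coprime to 𝔭₂; and (c) if v = 0 then b is even. Moreover, when these conditions hold, r_{2,K}(ν) = 4·∏_{𝔭}(1 + v_{𝔭}((ν))) if v ∈ {0, 2}, and r_{2,K}(ν) = 12·∏_{𝔭}(1 + v_{𝔭}((ν))) if v ≥ 4, where the product runs over the positive prime ideals 𝔭 coprime to 𝔭₂. -/

import Mathlib

/-!
Statements about sums of squares in K = ℚ(√3), with ring of integers O_K = ℤ[√3],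
realized as `Zsqrtd 3`.
-/

noncomputable section

namespace Paper3

/-- π₂ = 1 + √3 in ℤ[√3]. -/
def pi2 : Zsqrtd 3 := ⟨1, 1⟩

/-- The real embedding of ℤ[√3] sending √3 to √3. -/
def emb (x : Zsqrtd 3) : ℝ := (x.re : ℝ) + (x.im : ℝ) * Real.sqrt 3

/-- The real embedding of ℤ[√3] sending √3 to −√3. -/
def embConj (x : Zsqrtd 3) : ℝ := (x.re : ℝ) - (x.im : ℝ) * Real.sqrt 3

/-- An element of ℤ[√3] is totally positive if its images under both real embeddings
are positive. -/
def TotPos (x : Zsqrtd 3) : Prop := 0 < emb x ∧ 0 < embConj x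

/-- `r2 ν` is the number of pairs (x₁,x₂) ∈ O_K² with x₁² + x₂² = ν. -/
def r2 (ν : Zsqrtd 3) : ℕ :=
  Set.ncard {t : Zsqrtd 3 × Zsqrtd 3 | t.1 ^ 2 + t.2 ^ 2 = ν}

/-- The prime ideal 𝔭₂ = (π₂) of O_K, with (2) = 𝔭₂². -/
def p2 : Ideal (Zsqrtd 3) := Ideal.span {pi2}

/-- A nonzero ideal of O_K is positive if its generators have positive norm. -/
def PosIdeal (I : Ideal (Zsqrtd 3)) : Prop :=
  ∃ μ : Zsqrtd 3, I = Ideal.span {μ} ∧ 0 < Zsqrtd.norm μ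

/-- A nonzero ideal of O_K is negative if its generators have negative norm. -/
def NegIdeal (I : Ideal (Zsqrtd 3)) : Prop :=
  ∃ μ : Zsqrtd 3, I = Ideal.span {μ} ∧ Zsqrtd.norm μ < 0

open QuadraticAlgebra

/-! ### Total positivity in `ℤ[√3]` -/

theorem emb_add (x y : Zsqrtd 3) : emb (x + y) = emb x + emb y := by
  simp [emb]; ring

theorem emb_mul (x y : Zsqrtd 3) : emb (x * y) = emb x * emb y := by
  have h : Real.sqrt 3 * Real.sqrt 3 = 3 := Real.mul_self_sqrt (by norm_num)
  simp only [emb, Zsqrtd.re_mul, Zsqrtd.im_mul]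
  push_cast
  linear_combination (-(x.im * y.im : ℝ)) * h

theorem embConj_eq_emb_star (x : Zsqrtd 3) : embConj x = emb (star x) := by
  simp [emb, embConj, sub_eq_add_neg]

theorem emb_mul_embConj (x : Zsqrtd 3) : emb x * embConj x = x.norm := by
  rw [embConj_eq_emb_star, ← emb_mul, ← Zsqrtd.norm_eq_mul_conj]
  simp [emb]

theorem totPos_iff (x : Zsqrtd 3) : TotPos x ↔ 0 < x.re ∧ 0 < x.norm := by
  have h1 : emb x + embConj x = 2 * x.re := by simp [emb, embConj]; ring
  have h2 := emb_mul_embConj x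
  rw [← @Int.cast_pos ℝ, ← @Int.cast_pos ℝ, ← h2, TotPos]
  constructor
  · rintro ⟨ha, hb⟩
    exact ⟨by linarith, mul_pos ha hb⟩
  · rintro ⟨ha, hb⟩
    rcases pos_and_pos_or_neg_and_neg_of_mul_pos hb with h | h
    · exact h
    · linarith [h.1, h.2]

theorem norm_eq_zero_iff (x : Zsqrtd 3) : x.norm = 0 ↔ x = 0 :=
  Zsqrtd.norm_eq_zero (fun n h => by
    have h1 : n ≤ 1 := by nlinarith
    have h2 : -1 ≤ n := by nlinarith
    interval_cases n <;> omega) x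

theorem emb_eq_zero_iff (x : Zsqrtd 3) : emb x = 0 ↔ x = 0 := by
  refine ⟨fun h => ?_, fun h => by simp [h, emb]⟩
  have := emb_mul_embConj x
  rw [h, zero_mul] at this
  exact (norm_eq_zero_iff x).1 (by exact_mod_cast this.symm)

theorem TotPos.mul {x y : Zsqrtd 3} (hx : TotPos x) (hy : TotPos y) : TotPos (x * y) := by
  refine ⟨by rw [emb_mul]; exact mul_pos hx.1 hy.1, ?_⟩
  rw [embConj_eq_emb_star, star_mul', emb_mul, ← embConj_eq_emb_star, ← embConj_eq_emb_star]
  exact mul_pos hx.2 hy.2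

theorem totPos_one : TotPos 1 := by simp [totPos_iff]

theorem TotPos.pow {x : Zsqrtd 3} (hx : TotPos x) (k : ℕ) : TotPos (x ^ k) := by
  induction k with
  | zero => simpa using totPos_one
  | succ k ih => rw [pow_succ]; exact ih.mul hx

theorem TotPos.of_mul {x y : Zsqrtd 3} (hx : TotPos x) (h : TotPos (x * y)) : TotPos y := by
  refine ⟨?_, ?_⟩
  · have := h.1
    rw [emb_mul] at this
    exact (pos_iff_pos_of_mul_pos this).1 hx.1
  · have := h.2
    rw [embConj_eq_emb_star, star_mul', emb_mul, ← embConj_eq_emb_star,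
      ← embConj_eq_emb_star] at this
    exact (pos_iff_pos_of_mul_pos this).1 hx.2

theorem TotPos.ne_zero {x : Zsqrtd 3} (hx : TotPos x) : x ≠ 0 := by
  rintro rfl
  simp [totPos_iff] at hx

theorem totPos_sq {x : Zsqrtd 3} (hx : x ≠ 0) : TotPos (x ^ 2) := by
  have h1 : emb x ≠ 0 := by rwa [Ne, emb_eq_zero_iff]
  have h2 : emb (star x) ≠ 0 := by rwa [Ne, emb_eq_zero_iff, star_eq_zero]
  refine ⟨?_, ?_⟩
  · rw [sq, emb_mul]; exact mul_self_pos.2 h1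
  · rw [embConj_eq_emb_star, sq, star_mul', emb_mul]; exact mul_self_pos.2 h2

instance : IsDomain (Zsqrtd 3) :=
  have : NoZeroDivisors (Zsqrtd 3) := ⟨fun {a b} h => by
    have := congrArg Zsqrtd.norm h
    rw [Zsqrtd.norm_mul, Zsqrtd.norm_zero, mul_eq_zero] at this
    simpa only [norm_eq_zero_iff] using this⟩
  NoZeroDivisors.to_isDomain _

/-! ### Principal ideal rings -/

theorem isPrincipalIdealRing_of_division {R : Type*} [CommRing R] (N : R → ℕ)
    (h : ∀ a b, b ≠ 0 → ∃ q, N (a - b * q) < N b) : IsPrincipalIdealRing R := by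
  refine ⟨fun I => ?_⟩
  by_cases hI : I = ⊥
  · rw [hI]; infer_instance
  obtain ⟨b₀, hb₀, hb₀'⟩ := Submodule.exists_mem_ne_zero_of_ne_bot hI
  have hex : ∃ n, ∃ b ∈ I, b ≠ 0 ∧ N b = n := ⟨_, b₀, hb₀, hb₀', rfl⟩
  classical
  obtain ⟨b, hbI, hb, hbn⟩ := Nat.find_spec hex
  refine ⟨⟨b, le_antisymm (fun a ha => ?_) (Ideal.span_le.2 (by simpa using hbI))⟩⟩
  obtain ⟨q, hq⟩ := h a b hb
  by_cases h0 : a - b * q = 0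
  · exact Ideal.mem_span_singleton.2 ⟨q, sub_eq_zero.1 h0⟩
  · exact absurd (Nat.find_min' hex ⟨_, I.sub_mem ha (I.mul_mem_right q hbI), h0, rfl⟩)
      (by rw [← hbn]; exact hq.not_ge)

theorem exists_two_mul_abs_sub_mul_le (a : ℤ) {n : ℤ} (hn : 0 < n) :
    ∃ x : ℤ, |2 * (a - n * x)| ≤ n := by
  refine ⟨(2 * a + n) / (2 * n), ?_⟩
  have h1 := Int.emod_add_mul_ediv (2 * a + n) (2 * n)
  have h2 := Int.emod_nonneg (2 * a + n) (show 2 * n ≠ 0 by omega)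
  have h3 := Int.emod_lt_of_pos (2 * a + n) (show 0 < 2 * n by omega)
  rw [abs_le]
  constructor <;> linarith

instance : IsPrincipalIdealRing (Zsqrtd 3) := by
  refine isPrincipalIdealRing_of_division (fun x => x.norm.natAbs) fun a b hb => ?_
  set n := b.norm with hn
  have hn0 : n ≠ 0 := by rwa [hn, Ne, norm_eq_zero_iff]
  set m := |n| with hm
  have hm0 : 0 < m := abs_pos.2 hn0
  obtain ⟨x, hx⟩ := exists_two_mul_abs_sub_mul_le (a * star b).re hm0
  obtain ⟨y, hy⟩ := exists_two_mul_abs_sub_mul_le (a * star b).im hm0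
  obtain ⟨e, he⟩ : ∃ e : ℤ, m = n * e := by
    rcases abs_choice n with h | h
    · exact ⟨1, by rw [hm, h]; ring⟩
    · exact ⟨-1, by rw [hm, h]; ring⟩
  refine ⟨⟨e * x, e * y⟩, ?_⟩
  have key : (a - b * ⟨e * x, e * y⟩) * star b = a * star b - (m : Zsqrtd 3) * ⟨x, y⟩ := by
    have : (⟨e * x, e * y⟩ : Zsqrtd 3) = (e : Zsqrtd 3) * ⟨x, y⟩ := by ext <;> simp
    rw [this, he, Int.cast_mul, hn, Zsqrtd.norm_eq_mul_conj]
    ring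
  have key2 := congrArg Zsqrtd.norm key
  rw [Zsqrtd.norm_mul, Zsqrtd.norm_conj, ← hn] at key2
  have hlt : |(a * star b - (m : Zsqrtd 3) * ⟨x, y⟩).norm| < m ^ 2 := by
    rw [Zsqrtd.norm_def, Zsqrtd.re_sub, Zsqrtd.im_sub]
    simp only [Zsqrtd.re_mul, Zsqrtd.re_intCast, Zsqrtd.im_mul, Zsqrtd.im_intCast, zero_mul,
      mul_zero, add_zero] at hx hy ⊢
    have h1 := sq_le_sq' (abs_le.1 hx).1 (abs_le.1 hx).2
    have h2 := sq_le_sq' (abs_le.1 hy).1 (abs_le.1 hy).2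
    rw [abs_lt]
    constructor <;> nlinarith
  have h3 : |(a - b * ⟨e * x, e * y⟩).norm| * m < m * m := by
    rw [hm, ← abs_mul, key2, ← sq]
    exact hlt
  have h4 := lt_of_mul_lt_mul_right h3 hm0.le
  zify
  exact h4

/-! ### The ring `ℤ[ζ₁₂]` -/

/-- The ring `ℤ[ζ₁₂] = ℤ[√3][ζ]` with `ζ ^ 2 = √3 ζ - 1`. -/
abbrev CycInt : Type := QuadraticAlgebra (Zsqrtd 3) (-1) ⟨0, 1⟩

theorem norm_totPos {α : CycInt} (hα : α ≠ 0) : TotPos (norm α) := by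
  have h3 : Real.sqrt 3 * Real.sqrt 3 = 3 := Real.mul_self_sqrt (by norm_num)
  have aux : ∀ c r s : ℝ, c * c = 3 → (r ≠ 0 ∨ s ≠ 0) → 0 < r * r + c * r * s + s * s := by
    intro c r s hc h
    by_cases hs : s = 0
    · subst hs
      have : r ≠ 0 := by simpa using h
      have : 0 < r * r := mul_self_pos.2 this
      linarith
    · have : 0 < s * s := mul_self_pos.2 hs
      nlinarith [mul_self_nonneg (2 * r + c * s)]
  have hne : α.re ≠ 0 ∨ α.im ≠ 0 := by
    by_contra! h
    exact hα (QuadraticAlgebra.ext h.1 h.2)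
  have hN : norm α = α.re * α.re + ⟨0, 1⟩ * α.re * α.im + α.im * α.im := by
    rw [norm_def]; ring
  refine ⟨?_, ?_⟩
  · rw [hN]
    simp only [emb_add, emb_mul]
    refine aux _ _ _ (by simp [emb]) ?_
    simpa only [Ne, emb_eq_zero_iff] using hne
  · rw [embConj_eq_emb_star, hN]
    simp only [star_add, star_mul', emb_add, emb_mul]
    refine aux _ _ _ (by simp [emb]) ?_
    simpa only [Ne, emb_eq_zero_iff, star_eq_zero] using hne

theorem norm_eq_zero_iff' (α : CycInt) : norm α = 0 ↔ α = 0 := by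
  refine ⟨fun h => ?_, fun h => by simp [h]⟩
  by_contra hα
  exact (norm_totPos hα).ne_zero h

instance : IsDomain CycInt :=
  have : NoZeroDivisors CycInt := ⟨fun {a b} h => by
    have := congrArg QuadraticAlgebra.norm h
    rw [map_mul, QuadraticAlgebra.norm_zero, mul_eq_zero] at this
    simpa only [norm_eq_zero_iff'] using this⟩
  NoZeroDivisors.to_isDomain _

theorem re_norm (α : CycInt) : (norm α).re =
    (α.re.re ^ 2 + 3 * α.re.re * α.im.im + 3 * α.im.im ^ 2) +
    (α.im.re ^ 2 + 3 * α.im.re * α.re.im + 3 * α.re.im ^ 2) := by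
  simp [norm_def]; ring

theorem im_norm (α : CycInt) : (norm α).im =
    2 * (α.re.re * α.re.im + α.im.re * α.im.im) + α.re.re * α.im.re + 3 * α.re.im * α.im.im := by
  simp [norm_def]; ring

/-- Rounding with respect to the hexagonal form `r ^ 2 + 3 r s + 3 s ^ 2`. -/
theorem exists_hexagonal_rounding (a b : ℤ) {n : ℤ} (hn : 0 < n) : ∃ x y : ℤ,
    16 * ((a - n * x) ^ 2 + 3 * (a - n * x) * (b - n * y) + 3 * (b - n * y) ^ 2) ≤ 7 * n ^ 2 := by
  obtain ⟨y, hy⟩ := exists_two_mul_abs_sub_mul_le b hn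
  obtain ⟨x, hx⟩ := exists_two_mul_abs_sub_mul_le (2 * a + 3 * (b - n * y)) (n := 2 * n) (by omega)
  refine ⟨x, y, ?_⟩
  have h1 := sq_le_sq' (abs_le.1 hx).1 (abs_le.1 hx).2
  have h2 := sq_le_sq' (abs_le.1 hy).1 (abs_le.1 hy).2
  nlinarith

instance : IsPrincipalIdealRing CycInt := by
  refine isPrincipalIdealRing_of_division (fun x => (norm x).norm.natAbs) fun a b hb => ?_
  have hNb := norm_totPos hb
  set n := (norm b).norm with hn
  have hn0 : 0 < n := ((totPos_iff _).1 hNb).2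
  set γ : CycInt := star b * algebraMap _ _ (star (norm b)) with hγ
  have hbγ : b * γ = (n : CycInt) := by
    rw [hγ, ← mul_assoc, ← algebraMap_norm_eq_mul_star, ← map_mul, ← Zsqrtd.norm_eq_mul_conj,
      ← hn]
    simp
  obtain ⟨x, y, hxy⟩ := exists_hexagonal_rounding (a * γ).re.re (a * γ).im.im hn0
  obtain ⟨z, w, hzw⟩ := exists_hexagonal_rounding (a * γ).im.re (a * γ).re.im hn0
  refine ⟨⟨⟨x, w⟩, ⟨z, y⟩⟩, ?_⟩
  set s : CycInt := ⟨⟨x, w⟩, ⟨z, y⟩⟩ with hs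
  have key : (a - b * s) * γ = a * γ - (n : CycInt) * s := by
    rw [← hbγ]; ring
  set t := a * γ - (n : CycInt) * s with ht
  have hre : (norm t).re < n ^ 2 := by
    rw [re_norm]
    have e1 : t.re.re = (a * γ).re.re - n * x := by rw [ht, hs, re_sub, Zsqrtd.re_sub]; simp
    have e2 : t.re.im = (a * γ).re.im - n * w := by rw [ht, hs, re_sub, Zsqrtd.im_sub]; simp
    have e3 : t.im.re = (a * γ).im.re - n * z := by rw [ht, hs, im_sub, Zsqrtd.re_sub]; simp
    have e4 : t.im.im = (a * γ).im.im - n * y := by rw [ht, hs, im_sub, Zsqrtd.im_sub]; simp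
    rw [e1, e2, e3, e4]
    nlinarith
  have hN : ∀ u : CycInt, 0 ≤ (norm u).re ∧ 0 ≤ (norm u).norm := by
    intro u
    by_cases hu : u = 0
    · simp [hu]
    · have := (totPos_iff _).1 (norm_totPos hu)
      exact ⟨this.1.le, this.2.le⟩
  have ht4 : (norm t).norm < n ^ 4 := by
    rw [Zsqrtd.norm_def]
    nlinarith [(hN t).1, mul_self_nonneg (norm t).im]
  have hγ4 : n * (norm γ).norm = n ^ 4 := by
    have := congrArg (fun u : CycInt => (norm u).norm) hbγ
    simp only [map_mul, Zsqrtd.norm_mul, norm_intCast] at this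
    rw [← hn, ← Int.cast_pow, Zsqrtd.norm_intCast] at this
    rw [this]; ring
  have hγ0 : 0 < (norm γ).norm := (pos_iff_pos_of_mul_pos (by rw [hγ4]; positivity)).1 hn0
  have h1 : (norm (a - b * s)).norm * (norm γ).norm < n * (norm γ).norm := by
    rw [hγ4, ← Zsqrtd.norm_mul, ← map_mul, key]
    exact ht4
  have h2 := lt_of_mul_lt_mul_right h1 hγ0.le
  zify
  rwa [abs_of_nonneg (hN _).2, abs_of_pos hn0]

/-! ### Units -/

theorem norm_eq_one_of_isUnit {u : Zsqrtd 3} (hu : IsUnit u) : u.norm = 1 := by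
  rcases Int.isUnit_iff.1 ((Zsqrtd.isUnit_iff_norm_isUnit u).1 hu) with h | h
  · exact h
  · exfalso
    rw [Zsqrtd.norm_def] at h
    have h1 : (u.re * u.re) % 3 = 2 := by
      rw [mul_assoc] at h
      omega
    rcases (by omega : u.re % 3 = 0 ∨ u.re % 3 = 1 ∨ u.re % 3 = 2) with h | h | h <;>
      simp [Int.mul_emod, h] at h1

theorem norm_eq_of_associated {x y : Zsqrtd 3} (h : Associated x y) : x.norm = y.norm := by
  obtain ⟨u, rfl⟩ := h
  rw [Zsqrtd.norm_mul, norm_eq_one_of_isUnit u.isUnit, mul_one]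

theorem pell_isFundamental :
    Pell.IsFundamental (Pell.Solution₁.mk 2 1 (by norm_num) : Pell.Solution₁ 3) := by
  refine ⟨by simp, by simp, fun {a} ha => by rw [Pell.Solution₁.x_mk]; omega⟩

theorem exists_norm_eq_of_isUnit {u : Zsqrtd 3} (hu : IsUnit u) (hpos : TotPos u) :
    ∃ α : CycInt, norm α = u := by
  have hmem : u ∈ unitary (Zsqrtd 3) :=
    Zsqrtd.norm_eq_one_iff_mem_unitary.1 (norm_eq_one_of_isUnit hu)
  set ε : Pell.Solution₁ 3 := Pell.Solution₁.mk 2 1 (by norm_num) with hε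
  have hpow : ∀ n : ℤ, ∃ α : CycInt, norm α = ((ε ^ n : Pell.Solution₁ 3) : Zsqrtd 3) := by
    intro n
    obtain ⟨k, rfl | rfl⟩ := n.eq_nat_or_neg
    · refine ⟨⟨1, 1⟩ ^ k, ?_⟩
      rw [map_pow, zpow_natCast]
      exact congrArg (· ^ k) (show norm (⟨1, 1⟩ : CycInt) = ⟨2, 1⟩ by decide)
    · refine ⟨⟨1, -1⟩ ^ k, ?_⟩
      rw [map_pow, zpow_neg, zpow_natCast, ← inv_pow]
      exact congrArg (· ^ k) (show norm (⟨1, -1⟩ : CycInt) = ⟨2, -1⟩ by decide)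
  rcases pell_isFundamental.eq_zpow_or_neg_zpow ⟨u, hmem⟩ with ⟨n, h | h⟩
  · obtain ⟨α, hα⟩ := hpow n
    exact ⟨α, hα.trans (congrArg Subtype.val h).symm⟩
  · exfalso
    obtain ⟨α, hα⟩ := hpow n
    have h' : u = -norm α := by rw [hα]; exact congrArg Subtype.val h
    have hα0 : α ≠ 0 := by
      rintro rfl
      exact hpos.ne_zero (by simpa using h')
    have h1 := ((totPos_iff _).1 (norm_totPos hα0)).1
    have h2 := ((totPos_iff _).1 hpos).1
    rw [h', Zsqrtd.re_neg] at h2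
    omega

/-- The elements of `ℤ[ζ₁₂]` with a given relative norm. -/
def normFiber (ν : Zsqrtd 3) : Set CycInt := {α | norm α = ν}

theorem mem_normFiber {ν : Zsqrtd 3} {α : CycInt} : α ∈ normFiber ν ↔ norm α = ν := Iff.rfl

theorem hexagonal_nonneg (r s : ℤ) : 0 ≤ r ^ 2 + 3 * r * s + 3 * s ^ 2 := by
  nlinarith [sq_nonneg (2 * r + 3 * s), sq_nonneg s]

theorem hexagonal_eq_zero {r s : ℤ} (h : r ^ 2 + 3 * r * s + 3 * s ^ 2 = 0) : r = 0 ∧ s = 0 := by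
  have hs : s = 0 := by
    rw [← sq_eq_zero_iff]
    nlinarith [sq_nonneg (2 * r + 3 * s), sq_nonneg s]
  subst hs
  exact ⟨by simpa using h, rfl⟩

theorem hexagonal_eq_one {r s : ℤ} (h : r ^ 2 + 3 * r * s + 3 * s ^ 2 = 1) :
    (r, s) = (1, 0) ∨ (r, s) = (-1, 0) ∨ (r, s) = (-1, 1) ∨ (r, s) = (-2, 1) ∨
      (r, s) = (1, -1) ∨ (r, s) = (2, -1) := by
  have h1 : s ≤ 1 := by nlinarith [sq_nonneg (2 * r + 3 * s)]
  have h2 : -1 ≤ s := by nlinarith [sq_nonneg (2 * r + 3 * s)]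
  have h3 : r ≤ 2 := by nlinarith [sq_nonneg (r + 2 * s)]
  have h4 : -2 ≤ r := by nlinarith [sq_nonneg (r + 2 * s)]
  interval_cases s <;> interval_cases r <;> simp_all

/-- The twelfth roots of unity. -/
def rootsOfUnityTwelve : Finset CycInt :=
  {⟨⟨1, 0⟩, ⟨0, 0⟩⟩, ⟨⟨-1, 0⟩, ⟨0, 0⟩⟩, ⟨⟨-1, 0⟩, ⟨0, 1⟩⟩, ⟨⟨-2, 0⟩, ⟨0, 1⟩⟩,
    ⟨⟨1, 0⟩, ⟨0, -1⟩⟩, ⟨⟨2, 0⟩, ⟨0, -1⟩⟩, ⟨⟨0, 0⟩, ⟨1, 0⟩⟩, ⟨⟨0, 0⟩, ⟨-1, 0⟩⟩,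
    ⟨⟨0, 1⟩, ⟨-1, 0⟩⟩, ⟨⟨0, 1⟩, ⟨-2, 0⟩⟩, ⟨⟨0, -1⟩, ⟨1, 0⟩⟩, ⟨⟨0, -1⟩, ⟨2, 0⟩⟩}

theorem normFiber_one : normFiber 1 = rootsOfUnityTwelve := by
  ext α
  constructor
  · intro h
    have h1 := re_norm α
    rw [mem_normFiber.1 h, Zsqrtd.re_one] at h1
    have hA := hexagonal_nonneg α.re.re α.im.im
    have hB := hexagonal_nonneg α.im.re α.re.im
    obtain ⟨⟨a, b⟩, ⟨c, d⟩⟩ := α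
    simp only at h1 hA hB
    rcases (by omega : a ^ 2 + 3 * a * d + 3 * d ^ 2 = 0 ∨ a ^ 2 + 3 * a * d + 3 * d ^ 2 = 1)
      with h0 | h0
    · obtain ⟨rfl, rfl⟩ := hexagonal_eq_zero h0
      have h2 := hexagonal_eq_one (r := c) (s := b) (by omega)
      simp only [Prod.mk.injEq] at h2
      rcases h2 with ⟨rfl, rfl⟩ | ⟨rfl, rfl⟩ | ⟨rfl, rfl⟩ | ⟨rfl, rfl⟩ | ⟨rfl, rfl⟩ | ⟨rfl, rfl⟩ <;>
        simp [rootsOfUnityTwelve]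
    · obtain ⟨rfl, rfl⟩ := hexagonal_eq_zero (r := c) (s := b) (by omega)
      have h2 := hexagonal_eq_one h0
      simp only [Prod.mk.injEq] at h2
      rcases h2 with ⟨rfl, rfl⟩ | ⟨rfl, rfl⟩ | ⟨rfl, rfl⟩ | ⟨rfl, rfl⟩ | ⟨rfl, rfl⟩ | ⟨rfl, rfl⟩ <;>
        simp [rootsOfUnityTwelve]
  · intro h
    have : ∀ β ∈ rootsOfUnityTwelve, norm β = 1 := by decide
    exact this α h

theorem normFiber_of_isUnit {u : Zsqrtd 3} (hu : IsUnit u) (hpos : TotPos u) :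
    (normFiber u).Finite ∧ (normFiber u).ncard = 12 := by
  obtain ⟨α, hα⟩ := exists_norm_eq_of_isUnit hu hpos
  have hαu : IsUnit α := by rw [isUnit_iff_norm_isUnit, hα]; exact hu
  have himage : normFiber u = (α * ·) '' normFiber 1 := by
    ext β
    constructor
    · intro hβ
      obtain ⟨γ, rfl⟩ := hαu.dvd (a := β)
      refine ⟨γ, ?_, rfl⟩
      rw [mem_normFiber, map_mul, hα] at hβ
      exact hu.mul_left_cancel (hβ.trans (mul_one u).symm)
    · rintro ⟨γ, hγ, rfl⟩
      rw [mem_normFiber] at hγ ⊢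
      rw [map_mul, hα, hγ, mul_one]
  rw [himage, Set.ncard_image_of_injective _ hαu.mul_right_injective, normFiber_one]
  refine ⟨(Finset.finite_toSet _).image _, ?_⟩
  rw [Set.ncard_coe_finset]
  rfl

/-! ### Behaviour of primes in `ℤ[ζ₁₂]` -/

theorem algebraMap_dvd_norm {x : Zsqrtd 3} {α : CycInt} (h : algebraMap _ _ x ∣ α) :
    x ^ 2 ∣ norm α := by
  obtain ⟨β, rfl⟩ := h
  simp

theorem associated_norm_of_norm_mul_norm_eq_sq {q : Zsqrtd 3} (hq : Prime q) {α β : CycInt}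
    (hα : ¬ IsUnit α) (hβ : ¬ IsUnit β) (h : norm α * norm β = q ^ 2) :
    Associated (norm α) q := by
  obtain ⟨i, hi, hassoc⟩ := (dvd_prime_pow hq 2).1 (Dvd.intro _ h)
  interval_cases i
  · exact absurd (isUnit_iff_norm_isUnit.2 (by simpa using hassoc)) hα
  · simpa using hassoc
  · obtain ⟨u, hu⟩ := hassoc.symm
    rw [← hu, mul_assoc] at h
    have := mul_left_cancel₀ (pow_ne_zero 2 hq.ne_zero) (h.trans (mul_one _).symm)
    exact absurd (isUnit_iff_norm_isUnit.2 (IsUnit.of_mul_eq_one _ ((mul_comm _ _).trans this))) hβ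

theorem prime_algebraMap_of_norm_neg {q : Zsqrtd 3} (hq : Prime q) (hneg : q.norm < 0) :
    Prime (algebraMap (Zsqrtd 3) CycInt q) := by
  rw [← irreducible_iff_prime]
  refine ⟨?_, fun {α β} h => ?_⟩
  · rw [isUnit_iff_norm_isUnit, QuadraticAlgebra.norm_algebraMap, isUnit_pow_iff two_ne_zero]
    exact hq.not_isUnit
  · have hN : norm α * norm β = q ^ 2 := by rw [← map_mul, ← h, QuadraticAlgebra.norm_algebraMap]
    by_contra! hu
    have h1 := norm_eq_of_associated (associated_norm_of_norm_mul_norm_eq_sq hq hu.1 hu.2 hN)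
    have hα : α ≠ 0 := by
      rintro rfl
      simp only [QuadraticAlgebra.norm_zero, zero_mul] at hN
      exact pow_ne_zero 2 hq.ne_zero hN.symm
    have := ((totPos_iff _).1 (norm_totPos hα)).2
    omega

/-- The coordinates on `ℤ[√3]`. -/
def coordEquiv : Zsqrtd 3 ≃ₗ[ℤ] (Fin 2 → ℤ) where
  toFun x := ![x.re, x.im]
  invFun v := ⟨v 0, v 1⟩
  map_add' x y := by ext i; fin_cases i <;> simp
  map_smul' n x := by ext i; fin_cases i <;> simp
  left_inv x := rfl
  right_inv v := by ext i; fin_cases i <;> rfl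

/-- The basis `1, √3` of `ℤ[√3]`. -/
def zsqrtdBasis : Module.Basis (Fin 2) ℤ (Zsqrtd 3) := .ofEquivFun coordEquiv

instance : Module.Free ℤ (Zsqrtd 3) := .of_basis zsqrtdBasis

instance : Module.Finite ℤ (Zsqrtd 3) := .of_basis zsqrtdBasis

@[simp]
theorem coordEquiv_apply (x : Zsqrtd 3) : coordEquiv x = ![x.re, x.im] := rfl

@[simp]
theorem coordEquiv_symm_apply (v : Fin 2 → ℤ) : coordEquiv.symm v = ⟨v 0, v 1⟩ := rfl

theorem algebraNorm_eq (x : Zsqrtd 3) : Algebra.norm ℤ x = x.norm := by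
  rw [Algebra.norm_eq_matrix_det zsqrtdBasis, Matrix.det_fin_two]
  simp [Algebra.leftMulMatrix_eq_repr_mul, zsqrtdBasis, Zsqrtd.norm_def]

theorem card_quotient_span (x : Zsqrtd 3) :
    Nat.card (Zsqrtd 3 ⧸ Ideal.span {x}) = x.norm.natAbs := by
  rw [← algebraNorm_eq, ← Ideal.absNorm_span_singleton, Ideal.absNorm_apply,
    Submodule.cardQuot_apply]

theorem pi2_norm : pi2.norm = -2 := rfl

theorem pi2_sq : pi2 ^ 2 = 2 * ⟨2, 1⟩ := rfl

theorem pi2_dvd_iff (x : Zsqrtd 3) : pi2 ∣ x ↔ Even (x.re + x.im) := by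
  constructor
  · rintro ⟨y, rfl⟩
    exact ⟨y.re + 2 * y.im, by simp [pi2]; ring⟩
  · rintro ⟨k, hk⟩
    exact ⟨⟨2 * x.im - k, k - x.im⟩, by ext <;> simp [pi2] <;> linarith⟩

theorem two_dvd_iff (x : Zsqrtd 3) : 2 ∣ x ↔ 2 ∣ x.re ∧ 2 ∣ x.im := by
  exact_mod_cast Zsqrtd.intCast_dvd 2 x

theorem prime_pi2 : Prime pi2 := by
  refine ⟨by decide, fun h => ?_, fun a b h => ?_⟩
  · have := norm_eq_one_of_isUnit h
    rw [pi2_norm] at this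
    omega
  · rw [pi2_dvd_iff] at h ⊢
    rw [pi2_dvd_iff, ← Int.even_mul]
    obtain ⟨k, hk⟩ := h
    rw [Zsqrtd.re_mul, Zsqrtd.im_mul] at hk
    exact ⟨k - a.im * b.im, by linarith⟩

theorem norm_eq_neg_two_of_dvd_two {q : Zsqrtd 3} (hq : Prime q) (h : q ∣ 2) : q.norm = -2 := by
  have h1 : q ∣ pi2 := hq.dvd_of_dvd_pow (n := 2) (pi2_sq ▸ h.mul_right _)
  rw [norm_eq_of_associated (hq.associated_of_dvd prime_pi2 h1), pi2_norm]

theorem exists_dvd_sq_add_one {q : Zsqrtd 3} (hq : Prime q) (hpos : 0 < q.norm) :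
    ∃ x, q ∣ x ^ 2 + 1 := by
  have hodd : ¬ Even (q.re + q.im) := by
    intro h
    have := norm_eq_of_associated
      (prime_pi2.associated_of_dvd hq ((pi2_dvd_iff q).2 h))
    rw [pi2_norm] at this
    omega
  have hmod : q.norm % 4 = 1 := by
    rw [Zsqrtd.norm_def]
    rcases Int.even_or_odd' q.re with ⟨a, ha | ha⟩ <;>
      rcases Int.even_or_odd' q.im with ⟨b, hb | hb⟩ <;> rw [ha, hb]
    · exact absurd ⟨a + b, by linarith⟩ hodd
    · ring_nf; omega
    · ring_nf; omega
    · exact absurd ⟨a + b + 1, by linarith⟩ hodd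
  have hprime : (Ideal.span {q}).IsPrime := (Ideal.span_singleton_prime hq.ne_zero).2 hq
  have hmax : (Ideal.span {q}).IsMaximal :=
    hprime.isMaximal (by simpa using hq.ne_zero)
  let _ : Field (Zsqrtd 3 ⧸ Ideal.span {q}) := Ideal.Quotient.field _
  have hcard := card_quotient_span q
  have : Finite (Zsqrtd 3 ⧸ Ideal.span {q}) := Nat.finite_of_card_ne_zero (by omega)
  let _ : Fintype (Zsqrtd 3 ⧸ Ideal.span {q}) := Fintype.ofFinite _
  have hsq : IsSquare (-1 : Zsqrtd 3 ⧸ Ideal.span {q}) := by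
    rw [FiniteField.isSquare_neg_one_iff, ← Nat.card_eq_fintype_card, hcard]
    omega
  obtain ⟨y, hy⟩ := hsq
  obtain ⟨x, rfl⟩ := Ideal.Quotient.mk_surjective y
  refine ⟨x, ?_⟩
  rw [← Ideal.mem_span_singleton, ← Ideal.Quotient.eq_zero_iff_mem, map_add, map_pow, map_one,
    sq, ← hy]
  ring

theorem star_dvd_star_iff {α β : CycInt} : star α ∣ star β ↔ α ∣ β := by
  refine ⟨fun ⟨γ, h⟩ => ⟨star γ, ?_⟩, fun ⟨γ, h⟩ => ⟨star γ, ?_⟩⟩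
  · rw [← star_star β, h, star_mul', star_star]
  · rw [h, star_mul']

theorem norm_dvd_norm {α β : CycInt} (h : α ∣ β) : norm α ∣ norm β := map_dvd _ h

theorem prime_of_prime_norm {π : CycInt} (h : Prime (norm π)) : Prime π := by
  rw [← irreducible_iff_prime]
  refine ⟨fun hu => h.not_isUnit (isUnit_iff_norm_isUnit.1 hu), fun {a b} hab => ?_⟩
  rw [isUnit_iff_norm_isUnit, isUnit_iff_norm_isUnit]
  exact h.irreducible.isUnit_or_isUnit (by rw [hab, map_mul])

theorem exists_split {q : Zsqrtd 3} (hq : Prime q) (hpos : 0 < q.norm) :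
    ∃ π : CycInt, Associated (norm π) q ∧ ¬ π ∣ star π := by
  obtain ⟨x, hx⟩ := exists_dvd_sq_add_one hq hpos
  have hq2 : ¬ q ∣ 2 := fun h => by
    have := norm_eq_neg_two_of_dvd_two hq h
    omega
  let δ : CycInt := ⟨x + ⟨0, -1⟩, 2⟩
  have hδ : norm δ = x ^ 2 + 1 := by
    ext <;> simp [δ, norm_def, sq] <;> ring
  have hδq : ¬ algebraMap _ _ q ∣ δ := fun h => hq2 (algebraMap_dvd_iff.1 h).2
  have hδ2 : δ - star δ = 2 * ⟨⟨0, -1⟩, 2⟩ := by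
    rw [sub_star]
    ext <;> simp [δ]
  have hdvd : algebraMap _ CycInt q ∣ δ * star δ := by
    rw [← algebraMap_norm_eq_mul_star, hδ]
    exact map_dvd _ hx
  have hnp : ¬ Prime (algebraMap (Zsqrtd 3) CycInt q) := by
    intro hp
    rcases hp.dvd_or_dvd hdvd with h | h
    · exact hδq h
    · rw [← star_dvd_star_iff, star_star] at h
      refine hδq ?_
      convert h using 1
      ext <;> simp [QuadraticAlgebra.algebraMap_eq]
  rw [← irreducible_iff_prime, irreducible_iff] at hnp
  have hqu : ¬ IsUnit (algebraMap (Zsqrtd 3) CycInt q) := by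
    rw [isUnit_iff_norm_isUnit, QuadraticAlgebra.norm_algebraMap, isUnit_pow_iff two_ne_zero]
    exact hq.not_isUnit
  push Not at hnp
  obtain ⟨π, β, hπβ, hπ, hβ⟩ := hnp hqu
  have hassoc : Associated (norm π) q :=
    associated_norm_of_norm_mul_norm_eq_sq hq hπ hβ
      (by rw [← map_mul, ← hπβ, QuadraticAlgebra.norm_algebraMap])
  have hπp : Prime π := prime_of_prime_norm (hassoc.prime_iff.2 hq)
  refine ⟨π, hassoc, fun hπs => ?_⟩
  have hπs' : star π ∣ π := by rwa [← star_dvd_star_iff, star_star]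
  have hmem : π ∣ δ * star δ := (Dvd.intro _ hπβ.symm).trans hdvd
  have hboth : π ∣ δ ∧ π ∣ star δ := by
    rcases hπp.dvd_or_dvd hmem with h | h
    · exact ⟨h, hπs.trans (star_dvd_star_iff.2 h)⟩
    · refine ⟨?_, h⟩
      rw [← star_dvd_star_iff, star_star] at h
      exact hπs.trans h
  have h2 := norm_dvd_norm (dvd_sub hboth.1 hboth.2)
  rw [hδ2, map_mul] at h2
  have h3 : norm (⟨⟨0, -1⟩, 2⟩ : CycInt) = 1 := by decide
  have h4 : norm (2 : CycInt) = 2 ^ 2 := by decide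
  rw [h3, h4, mul_one] at h2
  exact hq2 (hq.dvd_of_dvd_pow (hassoc.dvd_iff_dvd_left.1 h2))

/-! ### Counting elements of given relative norm -/

theorem algebraMap_dvd_of_dvd_norm {q : Zsqrtd 3} (hq : Prime (algebraMap (Zsqrtd 3) CycInt q))
    {α : CycInt} (h : q ∣ norm α) : algebraMap _ _ q ∣ α := by
  have h1 : algebraMap _ CycInt q ∣ α * star α := by
    rw [← algebraMap_norm_eq_mul_star]
    exact map_dvd _ h
  rcases hq.dvd_or_dvd h1 with h2 | h2
  · exact h2
  · rw [← star_dvd_star_iff, star_star] at h2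
    convert h2 using 1
    ext <;> simp [QuadraticAlgebra.algebraMap_eq]

theorem normFiber_sq_mul {q : Zsqrtd 3} (hq : Prime (algebraMap (Zsqrtd 3) CycInt q))
    (hq0 : q ≠ 0) (μ : Zsqrtd 3) :
    normFiber (q ^ 2 * μ) = (algebraMap _ CycInt q * ·) '' normFiber μ := by
  ext α
  constructor
  · intro h
    rw [mem_normFiber] at h
    obtain ⟨β, rfl⟩ := algebraMap_dvd_of_dvd_norm hq
      (h ▸ (dvd_pow_self q two_ne_zero).mul_right μ)
    refine ⟨β, ?_, rfl⟩
    rw [map_mul, QuadraticAlgebra.norm_algebraMap] at h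
    exact mul_left_cancel₀ (pow_ne_zero 2 hq0) h
  · rintro ⟨β, h, rfl⟩
    rw [mem_normFiber] at h ⊢
    rw [map_mul, QuadraticAlgebra.norm_algebraMap, h]

theorem normFiber_pow_even_mul {q : Zsqrtd 3} (hq : Prime (algebraMap (Zsqrtd 3) CycInt q))
    (hq0 : q ≠ 0) (μ : Zsqrtd 3) (j : ℕ) :
    normFiber (q ^ (2 * j) * μ) = (algebraMap _ CycInt q ^ j * ·) '' normFiber μ := by
  induction j with
  | zero => simp
  | succ j ih =>
    rw [show q ^ (2 * (j + 1)) * μ = q ^ 2 * (q ^ (2 * j) * μ) by ring, normFiber_sq_mul hq hq0, ih,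
      Set.image_image]
    simp only [pow_succ', mul_assoc]

theorem normFiber_pow_odd_mul {q : Zsqrtd 3} (hq : Prime (algebraMap (Zsqrtd 3) CycInt q))
    (hq0 : q ≠ 0) {μ : Zsqrtd 3} (hμ : ¬ q ∣ μ) {k : ℕ} (hk : Odd k) :
    normFiber (q ^ k * μ) = ∅ := by
  obtain ⟨j, rfl⟩ := hk
  rw [show q ^ (2 * j + 1) * μ = q ^ (2 * j) * (q * μ) by ring, normFiber_pow_even_mul hq hq0,
    Set.image_eq_empty, Set.eq_empty_iff_forall_notMem]
  intro α hα
  rw [mem_normFiber] at hα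
  have h := algebraMap_dvd_norm (algebraMap_dvd_of_dvd_norm hq (hα ▸ dvd_mul_right q μ))
  rw [hα, sq] at h
  exact hμ ((mul_dvd_mul_iff_left hq0).1 h)

theorem not_dvd_star_pow_mul {π : CycInt} (hp : Prime π) (hπ : ¬ π ∣ star π) {μ : Zsqrtd 3}
    (hμ : ¬ norm π ∣ μ) {β : CycInt} (hβ : norm β = μ) (k : ℕ) : ¬ π ∣ star π ^ k * β := by
  intro h
  rcases hp.dvd_or_dvd h with h | h
  · exact hπ (hp.dvd_of_dvd_pow h)
  · exact hμ (hβ ▸ norm_dvd_norm h)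

theorem exists_eq_star_pow_mul {π : CycInt} (hp : Prime π) {μ : Zsqrtd 3} {k : ℕ} {α : CycInt}
    (hα : norm α = norm π ^ k * μ) (h : ¬ π ∣ α) :
    ∃ β : CycInt, norm β = μ ∧ star π ^ k * β = α := by
  have hN : norm π ≠ 0 := by rw [Ne, norm_eq_zero_iff']; exact hp.ne_zero
  induction k generalizing α with
  | zero => exact ⟨α, by simpa using hα, by simp⟩
  | succ k ih =>
    have h1 : π ∣ α * star α := by
      rw [← algebraMap_norm_eq_mul_star, hα, pow_succ', mul_assoc, map_mul,
        algebraMap_norm_eq_mul_star, mul_assoc]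
      exact dvd_mul_right _ _
    have h2 : star π ∣ α := by
      rw [← star_dvd_star_iff, star_star]
      exact (hp.dvd_or_dvd h1).resolve_left h
    obtain ⟨γ, rfl⟩ := h2
    rw [map_mul, QuadraticAlgebra.norm_star, pow_succ', mul_assoc] at hα
    obtain ⟨β, hβ, rfl⟩ := ih (mul_left_cancel₀ hN hα) fun h3 => h (h3.mul_left _)
    exact ⟨β, hβ, by ring⟩

theorem normFiber_pow_mul {π : CycInt} (hp : Prime π) (hπ : ¬ π ∣ star π) {μ : Zsqrtd 3}
    (hμ : ¬ norm π ∣ μ) (hfin : (normFiber μ).Finite) (k : ℕ) :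
    (normFiber (norm π ^ k * μ)).Finite ∧
      (normFiber (norm π ^ k * μ)).ncard = (k + 1) * (normFiber μ).ncard := by
  have hN : norm π ≠ 0 := by rw [Ne, norm_eq_zero_iff']; exact hp.ne_zero
  have hπs : star π ≠ 0 := star_ne_zero.2 hp.ne_zero
  induction k with
  | zero => simpa using hfin
  | succ k ih =>
    have hunion : normFiber (norm π ^ (k + 1) * μ) =
        (π * ·) '' normFiber (norm π ^ k * μ) ∪ (star π ^ (k + 1) * ·) '' normFiber μ := by
      ext α
      constructor
      · intro h
        rw [mem_normFiber] at h
        by_cases hd : π ∣ α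
        · obtain ⟨β, rfl⟩ := hd
          rw [map_mul, pow_succ', mul_assoc] at h
          exact Or.inl ⟨β, mul_left_cancel₀ hN h, rfl⟩
        · obtain ⟨β, hβ, hβα⟩ := exists_eq_star_pow_mul hp h hd
          exact Or.inr ⟨β, hβ, hβα⟩
      · rintro (⟨β, h, rfl⟩ | ⟨β, h, rfl⟩) <;> rw [mem_normFiber] at h ⊢ <;> rw [map_mul, h]
        · ring
        · rw [map_pow, QuadraticAlgebra.norm_star]
    have hdisj : Disjoint ((π * ·) '' normFiber (norm π ^ k * μ))
        ((star π ^ (k + 1) * ·) '' normFiber μ) := by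
      rw [Set.disjoint_left]
      rintro _ ⟨β, -, rfl⟩ ⟨γ, hγ, h⟩
      exact not_dvd_star_pow_mul hp hπ hμ hγ (k + 1) (Dvd.intro _ h.symm)
    have hf1 := ih.1.image (π * ·)
    have hf2 := hfin.image (star π ^ (k + 1) * ·)
    rw [hunion, Set.ncard_union_eq hdisj hf1 hf2,
      Set.ncard_image_of_injective _ (mul_right_injective₀ hp.ne_zero),
      Set.ncard_image_of_injective _ (mul_right_injective₀ (pow_ne_zero _ hπs)), ih.2]
    exact ⟨hf1.union hf2, by ring⟩

/-! ### Exponents of prime ideals -/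

/-- `f P` is the exponent of `P` in the ideal generated by `ν`. -/
def IsExponent (ν : Zsqrtd 3) (f : Ideal (Zsqrtd 3) → ℕ) : Prop :=
  ∀ P : Ideal (Zsqrtd 3), P.IsPrime → P ≠ ⊥ →
    P ^ f P ∣ Ideal.span {ν} ∧ ¬ P ^ (f P + 1) ∣ Ideal.span {ν}

theorem span_pow_dvd_iff {q x : Zsqrtd 3} {k : ℕ} :
    Ideal.span {q} ^ k ∣ Ideal.span {x} ↔ q ^ k ∣ x := by
  rw [Ideal.span_singleton_pow, Ideal.span_singleton_dvd_span_singleton_iff_dvd]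

theorem exists_prime_generator {P : Ideal (Zsqrtd 3)} (hP : P.IsPrime) (h0 : P ≠ ⊥) :
    ∃ q, Prime q ∧ P = Ideal.span {q} := by
  obtain ⟨q, rfl⟩ := (IsPrincipalIdealRing.principal P).principal
  rw [Ideal.submodule_span_eq] at *
  have hq : q ≠ 0 := by simpa using h0
  exact ⟨q, (Ideal.span_singleton_prime hq).1 hP, rfl⟩

theorem span_isPrime {q : Zsqrtd 3} (hq : Prime q) :
    (Ideal.span {q}).IsPrime ∧ Ideal.span {q} ≠ ⊥ :=
  ⟨(Ideal.span_singleton_prime hq.ne_zero).2 hq, by simpa using hq.ne_zero⟩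

theorem IsExponent.span {ν : Zsqrtd 3} {f : Ideal (Zsqrtd 3) → ℕ} (hf : IsExponent ν f)
    {q : Zsqrtd 3} (hq : Prime q) :
    q ^ f (Ideal.span {q}) ∣ ν ∧ ¬ q ^ (f (Ideal.span {q}) + 1) ∣ ν := by
  have := hf _ (span_isPrime hq).1 (span_isPrime hq).2
  rwa [span_pow_dvd_iff, span_pow_dvd_iff] at this

theorem isExponent_update {q μ : Zsqrtd 3} (hq : Prime q) (hμ : ¬ q ∣ μ) {k : ℕ}
    {f : Ideal (Zsqrtd 3) → ℕ} (hf : IsExponent (q ^ k * μ) f) [DecidableEq (Ideal (Zsqrtd 3))] :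
    IsExponent μ (Function.update f (Ideal.span {q}) 0) := by
  intro P hP hP0
  obtain ⟨p, hp, rfl⟩ := exists_prime_generator hP hP0
  by_cases h : Ideal.span {p} = Ideal.span {q}
  · rw [h, Function.update_self, zero_add, span_pow_dvd_iff, span_pow_dvd_iff]
    simpa using hμ
  · rw [Function.update_of_ne h, span_pow_dvd_iff, span_pow_dvd_iff]
    have hcop : ∀ j : ℕ, p ^ j ∣ q ^ k * μ ↔ p ^ j ∣ μ := by
      intro j
      refine ⟨fun hd => ?_, fun hd => hd.mul_left _⟩
      have hpq : IsCoprime p q := by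
        rw [hp.coprime_iff_not_dvd]
        exact fun hd => h (Ideal.span_singleton_eq_span_singleton.2 (hp.associated_of_dvd hq hd))
      exact hpq.pow.dvd_of_dvd_mul_left hd
    rw [← hcop, ← hcop]
    exact hf.span hp

theorem IsExponent.eq_of_not_dvd {q μ : Zsqrtd 3} (hq : Prime q) (hμ : ¬ q ∣ μ) {k : ℕ}
    {f : Ideal (Zsqrtd 3) → ℕ} (hf : IsExponent (q ^ k * μ) f) : f (Ideal.span {q}) = k := by
  obtain ⟨h1, h2⟩ := hf.span hq
  have h3 : ∀ j, q ^ j ∣ q ^ k * μ → j ≤ k := by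
    intro j hj
    by_contra! hlt
    have := (pow_dvd_pow q hlt).trans hj
    rw [pow_succ, mul_dvd_mul_iff_left (pow_ne_zero _ hq.ne_zero)] at this
    exact hμ this
  refine le_antisymm (h3 _ h1) ?_
  by_contra! hlt
  exact h2 ((pow_dvd_pow q hlt).trans (dvd_mul_right _ _))

/-- The positive prime ideals. -/
def posPrimes : Set (Ideal (Zsqrtd 3)) := {P | P.IsPrime ∧ P ≠ ⊥ ∧ PosIdeal P}

theorem posIdeal_span_iff {q : Zsqrtd 3} : PosIdeal (Ideal.span {q}) ↔ 0 < q.norm := by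
  refine ⟨fun ⟨x, h, hx⟩ => ?_, fun h => ⟨q, rfl, h⟩⟩
  rwa [norm_eq_of_associated (Ideal.span_singleton_eq_span_singleton.1 h)]

theorem negIdeal_span_iff {q : Zsqrtd 3} : NegIdeal (Ideal.span {q}) ↔ q.norm < 0 := by
  refine ⟨fun ⟨x, h, hx⟩ => ?_, fun h => ⟨q, rfl, h⟩⟩
  rwa [norm_eq_of_associated (Ideal.span_singleton_eq_span_singleton.1 h)]

/-- The exponent function is even at all negative prime ideals. -/
def EvenAtNeg (f : Ideal (Zsqrtd 3) → ℕ) : Prop :=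
  ∀ Q : Ideal (Zsqrtd 3), Q.IsPrime → Q ≠ ⊥ → NegIdeal Q → Even (f Q)

theorem evenAtNeg_update {f : Ideal (Zsqrtd 3) → ℕ} {P : Ideal (Zsqrtd 3)}
    (h : NegIdeal P → Even (f P)) [DecidableEq (Ideal (Zsqrtd 3))] :
    EvenAtNeg (Function.update f P 0) ↔ EvenAtNeg f := by
  refine forall_congr' fun Q => forall_congr' fun h1 => forall_congr' fun h2 =>
    forall_congr' fun h3 => ?_
  by_cases hQ : Q = P
  · subst hQ
    simpa using h h3
  · rw [Function.update_of_ne hQ]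

theorem IsExponent.finite_mulSupport {ν : Zsqrtd 3} (hν : ν ≠ 0) {f : Ideal (Zsqrtd 3) → ℕ}
    (hf : IsExponent ν f) :
    (posPrimes ∩ Function.mulSupport fun P => (1 + f P : ℤ)).Finite := by
  refine ((Ideal.finite_factors (I := Ideal.span {ν}) (by simpa using hν)).image
    IsDedekindDomain.HeightOneSpectrum.asIdeal).subset ?_
  rintro P ⟨⟨hP, hP0, -⟩, h⟩
  refine ⟨⟨P, hP, hP0⟩, ?_, rfl⟩
  exact (dvd_pow_self P (by simpa using h)).trans (hf P hP hP0).1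

theorem finprod_mem_posPrimes {ν : Zsqrtd 3} (hν : ν ≠ 0) {f : Ideal (Zsqrtd 3) → ℕ}
    (hf : IsExponent ν f) {P : Ideal (Zsqrtd 3)} (hP : P ∈ posPrimes)
    [DecidableEq (Ideal (Zsqrtd 3))] :
    ∏ᶠ Q ∈ posPrimes, (1 + f Q : ℤ) =
      (1 + f P) * ∏ᶠ Q ∈ posPrimes, (1 + Function.update f P 0 Q : ℤ) := by
  have hfin := hf.finite_mulSupport hν
  have h1 : P ∉ posPrimes \ {P} := by simp
  have h2 : insert P (posPrimes \ {P}) = posPrimes := by simpa using Set.insert_eq_of_mem hP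
  have hcongr : ∀ Q ∈ posPrimes \ {P}, (1 + f Q : ℤ) = 1 + Function.update f P 0 Q := by
    rintro Q ⟨-, hQ⟩
    rw [Function.update_of_ne hQ]
  have h3 : (posPrimes \ {P} ∩ Function.mulSupport fun Q => (1 + f Q : ℤ)).Finite :=
    hfin.subset (Set.inter_subset_inter_left _ Set.sdiff_subset)
  have h4 : (posPrimes \ {P} ∩
      Function.mulSupport fun Q => (1 + Function.update f P 0 Q : ℤ)).Finite := by
    refine h3.subset ?_
    rintro Q ⟨hQ, h⟩
    exact ⟨hQ, fun h' => h ((hcongr Q hQ).symm.trans h')⟩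
  rw [← h2, finprod_mem_insert' _ h1 h3, finprod_mem_insert' _ h1 h4, finprod_mem_congr rfl hcongr]
  simp

theorem normFiber_ncard {ν : Zsqrtd 3} (hν : TotPos ν) {f : Ideal (Zsqrtd 3) → ℕ}
    (hf : IsExponent ν f) :
    (normFiber ν).Finite ∧ (¬ EvenAtNeg f → normFiber ν = ∅) ∧
      (EvenAtNeg f → ((normFiber ν).ncard : ℤ) = 12 * ∏ᶠ P ∈ posPrimes, (1 + f P : ℤ)) := by
  classical
  induction hn : ν.norm.natAbs using Nat.strong_induction_on generalizing ν f with
  | _ n ih =>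
  by_cases hu : IsUnit ν
  · have hf0 : ∀ P : Ideal (Zsqrtd 3), P.IsPrime → P ≠ ⊥ → f P = 0 := by
      intro P hP hP0
      obtain ⟨q, hq, rfl⟩ := exists_prime_generator hP hP0
      by_contra h
      exact hq.not_isUnit (isUnit_of_dvd_unit ((dvd_pow_self q h).trans (hf.span hq).1) hu)
    obtain ⟨h1, h2⟩ := normFiber_of_isUnit hu hν
    refine ⟨h1, fun h => absurd (fun Q hQ hQ0 _ => by simp [hf0 Q hQ hQ0]) h, fun _ => ?_⟩
    rw [h2, finprod_mem_congr rfl fun P hP => show (1 + f P : ℤ) = 1 by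
      simp [hf0 P hP.1 hP.2.1], finprod_mem_one]
    rfl
  obtain ⟨q, hq, hqν⟩ := WfDvdMonoid.exists_irreducible_factor hu hν.ne_zero
  replace hq := hq.prime
  -- replace the generator by a norm when it is positive
  obtain ⟨p, hpq, hp⟩ : ∃ p, Associated p q ∧ (p.norm < 0 ∨ ∃ π : CycInt, norm π = p ∧
      ¬ π ∣ star π) := by
    rcases lt_trichotomy q.norm 0 with h | h | h
    · exact ⟨q, Associated.refl q, Or.inl h⟩
    · exact absurd ((norm_eq_zero_iff q).1 h) hq.ne_zero
    · obtain ⟨π, h1, h2⟩ := exists_split hq h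
      exact ⟨norm π, h1, Or.inr ⟨π, rfl, h2⟩⟩
  have hpp : Prime p := hpq.prime_iff.2 hq
  have hpν : p ∣ ν := hpq.dvd.trans hqν
  obtain ⟨μ, hνμ, hμ⟩ :=
    (FiniteMultiplicity.of_prime_left hpp hν.ne_zero).exists_eq_pow_mul_and_not_dvd
  generalize multiplicity p ν = k at hνμ
  subst hνμ
  have hk : k ≠ 0 := by
    rintro rfl
    exact hμ (by simpa using hpν)
  have hfk := hf.eq_of_not_dvd hpp hμ
  have hf' := isExponent_update hpp hμ hf
  have hlt : μ.norm.natAbs < n := by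
    rw [← hn, Zsqrtd.norm_mul, Int.natAbs_mul]
    have h1 : 1 < (p ^ k).norm.natAbs := by
      have h2 : (p ^ k).norm.natAbs ≠ 1 := by
        rw [Ne, Zsqrtd.norm_eq_one_iff, isUnit_pow_iff hk]
        exact hpp.not_isUnit
      have h3 : (p ^ k).norm.natAbs ≠ 0 := by
        rw [Ne, Int.natAbs_eq_zero, norm_eq_zero_iff]
        exact pow_ne_zero _ hpp.ne_zero
      omega
    have h4 : 0 < μ.norm.natAbs := by
      rw [Int.natAbs_pos, Ne, norm_eq_zero_iff]
      rintro rfl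
      exact hμ (dvd_zero p)
    nlinarith
  rcases hp with hneg | ⟨π, rfl, hπ⟩
  · have hPneg : NegIdeal (Ideal.span {p}) := negIdeal_span_iff.2 hneg
    have hPpos : Ideal.span {p} ∉ posPrimes := fun h => by
      have := posIdeal_span_iff.1 h.2.2
      omega
    have hinert := prime_algebraMap_of_norm_neg hpp hneg
    rcases Nat.even_or_odd' k with ⟨j, rfl | rfl⟩
    · have hj0 : algebraMap (Zsqrtd 3) CycInt p ^ j ≠ 0 := pow_ne_zero _ hinert.ne_zero
      have hpos : TotPos (p ^ (2 * j)) := by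
        rw [mul_comm, pow_mul]
        exact totPos_sq (pow_ne_zero _ hpp.ne_zero)
      obtain ⟨i1, i2, i3⟩ := ih _ hlt (hpos.of_mul hν) hf' rfl
      rw [evenAtNeg_update fun _ => by rw [hfk]; exact even_two_mul j] at i2 i3
      rw [normFiber_pow_even_mul hinert hpp.ne_zero]
      refine ⟨i1.image _, fun h => by rw [i2 h, Set.image_empty], fun h => ?_⟩
      rw [Set.ncard_image_of_injective _ (mul_right_injective₀ hj0), i3 h]
      refine congrArg _ (finprod_mem_congr rfl fun P hP => ?_)
      rw [Function.update_of_ne]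
      rintro rfl
      exact hPpos hP
    · rw [normFiber_pow_odd_mul hinert hpp.ne_zero hμ (odd_two_mul_add_one j)]
      refine ⟨Set.finite_empty, fun _ => rfl, fun h => ?_⟩
      have := h _ (span_isPrime hpp).1 (span_isPrime hpp).2 hPneg
      rw [hfk] at this
      exact absurd this (Nat.not_even_iff_odd.2 (odd_two_mul_add_one j))
  · have hppos : TotPos (norm π) := norm_totPos (by rintro rfl; simp at hpp)
    have hnorm := ((totPos_iff _).1 hppos).2
    have hPpos : Ideal.span {norm π} ∈ posPrimes :=
      ⟨(span_isPrime hpp).1, (span_isPrime hpp).2, posIdeal_span_iff.2 hnorm⟩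
    obtain ⟨i1, i2, i3⟩ := ih _ hlt ((hppos.pow k).of_mul hν) hf' rfl
    rw [evenAtNeg_update fun h => absurd (negIdeal_span_iff.1 h) hnorm.not_gt] at i2 i3
    obtain ⟨j1, j2⟩ := normFiber_pow_mul (prime_of_prime_norm hpp) hπ hμ i1 k
    refine ⟨j1, fun h => ?_, fun h => ?_⟩
    · rw [← Set.ncard_eq_zero j1, j2, i2 h, Set.ncard_empty, mul_zero]
    · rw [j2, Nat.cast_mul, i3 h, finprod_mem_posPrimes hν.ne_zero hf hPpos, hfk]
      push_cast
      ring

/-! ### Sums of two squares -/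

/-- The elements of `ℤ[√3][i] ⊆ ℤ[ζ₁₂]` with a given relative norm. -/
def gaussFiber (ν : Zsqrtd 3) : Set CycInt := {α ∈ normFiber ν | 2 ∣ α.im}

/-- The embedding `(x, y) ↦ x + i y`, where `i = 2 ζ - √3`. -/
def gauss (t : Zsqrtd 3 × Zsqrtd 3) : CycInt := ⟨t.1 + ⟨0, -1⟩ * t.2, 2 * t.2⟩

theorem norm_gauss (t : Zsqrtd 3 × Zsqrtd 3) : norm (gauss t) = t.1 ^ 2 + t.2 ^ 2 := by
  rw [norm_def, gauss]
  ext <;> simp [sq] <;> ring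

theorem gauss_injective : Function.Injective gauss := by
  rintro ⟨x, y⟩ ⟨z, w⟩ h
  simp only [gauss, QuadraticAlgebra.mk.injEq] at h
  obtain ⟨h1, h2⟩ := h
  obtain rfl := mul_left_cancel₀ two_ne_zero h2
  rw [add_left_inj] at h1
  rw [h1]

theorem image_gauss (ν : Zsqrtd 3) : gauss '' {t | t.1 ^ 2 + t.2 ^ 2 = ν} = gaussFiber ν := by
  ext α
  constructor
  · rintro ⟨t, ht, rfl⟩
    exact ⟨(norm_gauss t).trans ht, Dvd.intro _ rfl⟩
  · rintro ⟨hα, y, hy⟩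
    have h : gauss (α.re - ⟨0, -1⟩ * y, y) = α := by
      ext1
      · simp [gauss]
      · exact hy.symm
    refine ⟨_, ?_, h⟩
    exact (norm_gauss _).symm.trans (by rw [h]; exact hα)

theorem r2_eq (ν : Zsqrtd 3) : r2 ν = (gaussFiber ν).ncard := by
  rw [r2, ← image_gauss, Set.ncard_image_of_injective _ gauss_injective]

theorem gaussFiber_nonempty_iff (ν : Zsqrtd 3) :
    (gaussFiber ν).Nonempty ↔ ∃ x y : Zsqrtd 3, x ^ 2 + y ^ 2 = ν := by
  rw [← image_gauss, Set.image_nonempty]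
  exact Prod.exists

theorem ncard_filter_pi2_dvd_im {μ : Zsqrtd 3} (hμ : ¬ pi2 ∣ μ) (hfin : (normFiber μ).Finite) :
    3 * {α ∈ normFiber μ | pi2 ∣ α.im}.ncard = (normFiber μ).ncard := by
  set A := {α ∈ normFiber μ | pi2 ∣ α.im} with hA
  set B := {α ∈ normFiber μ | pi2 ∣ α.re} with hB
  set C := {α ∈ normFiber μ | pi2 ∣ α.re + α.im} with hC
  have hAf : A.Finite := hfin.subset (Set.sep_subset _ _)
  have hBf : B.Finite := hfin.subset (Set.sep_subset _ _)
  have hCf : C.Finite := hfin.subset (Set.sep_subset _ _)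
  set ζ : CycInt := ⟨0, 1⟩ with hζ
  have hζ0 : ζ ≠ 0 := by rw [hζ]; decide
  have hζN : norm ζ = 1 := by rw [hζ]; decide
  have hmem : ∀ α ∈ normFiber μ, ζ * α ∈ normFiber μ := fun α hα => by
    rw [mem_normFiber, map_mul, hζN, one_mul]; exact hα
  have hre : ∀ α, (ζ * α).re = -α.im := fun α => by simp [hζ]
  have him : ∀ α, (ζ * α).im = α.re + α.im + pi2 * ⟨2, -1⟩ * α.im := fun α => by
    rw [show pi2 * ⟨2, -1⟩ = ⟨0, 1⟩ - 1 by decide]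
    simp [hζ]; ring
  have hinj : ∀ S : Set CycInt, Set.InjOn (ζ * ·) S :=
    fun S => (mul_right_injective₀ hζ0).injOn
  have hAB : A.ncard ≤ B.ncard := Set.ncard_le_ncard_of_injOn (ζ * ·) (fun α hα =>
    ⟨hmem α hα.1, by rw [hre]; exact hα.2.neg_right⟩) (hinj A) hBf
  have hBC : B.ncard ≤ C.ncard := Set.ncard_le_ncard_of_injOn (ζ * ·) (fun α hα =>
    ⟨hmem α hα.1, by
      rw [hre, him, mul_assoc, show -α.im + (α.re + α.im + pi2 * (⟨2, -1⟩ * α.im)) =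
        α.re + pi2 * (⟨2, -1⟩ * α.im) by ring]
      exact dvd_add hα.2 (dvd_mul_right _ _)⟩) (hinj B) hCf
  have hCA : C.ncard ≤ A.ncard := Set.ncard_le_ncard_of_injOn (ζ * ·) (fun α hα =>
    ⟨hmem α hα.1, by
      rw [him, mul_assoc]
      exact dvd_add hα.2 (dvd_mul_right _ _)⟩) (hinj C) hAf
  have hnot : ∀ α ∈ normFiber μ, pi2 ∣ α.re → ¬ pi2 ∣ α.im := fun α hα h1 h2 => hμ <| by
    rw [← mem_normFiber.1 hα, norm_def]
    exact dvd_sub (dvd_add (h1.mul_right _) (h2.mul_left _)) (h2.mul_left _)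
  have hunion : normFiber μ = A ∪ B ∪ C := by
    ext α
    refine ⟨fun h => ?_, fun h => ?_⟩
    · have : pi2 ∣ α.im ∨ pi2 ∣ α.re ∨ pi2 ∣ α.re + α.im := by
        simp only [pi2_dvd_iff, Zsqrtd.re_add, Zsqrtd.im_add, Int.even_add]
        tauto
      rcases this with h' | h' | h'
      · exact Or.inl (Or.inl ⟨h, h'⟩)
      · exact Or.inl (Or.inr ⟨h, h'⟩)
      · exact Or.inr ⟨h, h'⟩
    · rcases h with (h | h) | h <;> exact h.1
  have hd1 : Disjoint A B := Set.disjoint_left.2 fun α h1 h2 => hnot α h1.1 h2.2 h1.2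
  have hd2 : Disjoint (A ∪ B) C := Set.disjoint_left.2 fun α h1 h2 => by
    rcases h1 with h1 | h1
    · exact hnot α h1.1 ((dvd_add_left h1.2).1 h2.2) h1.2
    · exact hnot α h1.1 h1.2 ((dvd_add_right h1.2).1 h2.2)
  rw [hunion, Set.ncard_union_eq hd2 (hAf.union hBf) hCf, Set.ncard_union_eq hd1 hAf hBf]
  omega

theorem even_im_of_mem_gaussFiber {ν : Zsqrtd 3} {α : CycInt} (hα : α ∈ gaussFiber ν) :
    Even ν.im := by
  obtain ⟨hN, h2⟩ := hα
  rw [two_dvd_iff, ← even_iff_two_dvd, ← even_iff_two_dvd] at h2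
  rw [← mem_normFiber.1 hN, im_norm]
  simp [h2, parity_simps]

theorem gaussFiber_of_not_dvd {ν : Zsqrtd 3} (hν : ¬ pi2 ∣ ν) (him : Even ν.im) :
    gaussFiber ν = {α ∈ normFiber ν | pi2 ∣ α.im} := by
  ext α
  refine and_congr_right fun hα => ?_
  have h1 := re_norm α
  have h2 := im_norm α
  rw [mem_normFiber.1 hα] at h1 h2
  rw [h2] at him
  rw [pi2_dvd_iff, h1, h2] at hν
  rw [two_dvd_iff, ← even_iff_two_dvd, ← even_iff_two_dvd, pi2_dvd_iff]
  have h3 : ¬ Even (3 : ℤ) := by decide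
  simp only [Int.even_add, Int.even_mul, Int.even_pow, even_two, h3] at him hν ⊢
  by_cases Even α.re.re <;> by_cases Even α.re.im <;> by_cases Even α.im.re <;>
    by_cases Even α.im.im <;> simp_all

theorem two_dvd_pi2_mul_iff (x : Zsqrtd 3) : 2 ∣ pi2 * x ↔ pi2 ∣ x := by
  rw [two_dvd_iff, pi2_dvd_iff, ← even_iff_two_dvd, ← even_iff_two_dvd]
  simp [pi2, parity_simps]
  tauto

theorem prime_algebraMap_pi2 : Prime (algebraMap (Zsqrtd 3) CycInt pi2) :=
  prime_algebraMap_of_norm_neg prime_pi2 (by rw [pi2_norm]; norm_num)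

theorem im_algebraMap_mul (x : Zsqrtd 3) (α : CycInt) :
    (algebraMap (Zsqrtd 3) CycInt x * α).im = x * α.im := by
  simp

theorem gaussFiber_pi2_sq_mul (μ : Zsqrtd 3) : gaussFiber (pi2 ^ 2 * μ) =
    (algebraMap (Zsqrtd 3) CycInt pi2 * ·) '' {α ∈ normFiber μ | pi2 ∣ α.im} := by
  rw [gaussFiber, normFiber_sq_mul prime_algebraMap_pi2 prime_pi2.ne_zero]
  ext α
  constructor
  · rintro ⟨⟨β, hβ, rfl⟩, h⟩
    exact ⟨β, ⟨hβ, (two_dvd_pi2_mul_iff _).1 (by simpa only [im_algebraMap_mul] using h)⟩, rfl⟩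
  · rintro ⟨β, ⟨hβ, h⟩, rfl⟩
    exact ⟨⟨β, hβ, rfl⟩, by
      simp only [im_algebraMap_mul]
      exact (two_dvd_pi2_mul_iff _).2 h⟩

theorem gaussFiber_pi2_pow_four_mul (μ : Zsqrtd 3) :
    gaussFiber (pi2 ^ 4 * μ) = normFiber (pi2 ^ 4 * μ) := by
  refine Set.sep_eq_self_iff_mem_true.2 fun α hα => ?_
  rw [normFiber_pow_even_mul prime_algebraMap_pi2 prime_pi2.ne_zero μ 2] at hα
  obtain ⟨β, -, rfl⟩ := hα
  simp only [← map_pow, im_algebraMap_mul]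
  rw [pi2_sq, mul_assoc]
  exact dvd_mul_right _ _

theorem three_mul_r2 {ν : Zsqrtd 3} (hfin : (normFiber ν).Finite) {v : ℕ}
    (hv : pi2 ^ v ∣ ν ∧ ¬ pi2 ^ (v + 1) ∣ ν) (h : v = 0 ∧ Even ν.im ∨ v = 2) :
    3 * r2 ν = (normFiber ν).ncard := by
  rw [r2_eq]
  rcases h with ⟨rfl, h⟩ | rfl
  · have hν : ¬ pi2 ∣ ν := by simpa using hv.2
    rw [gaussFiber_of_not_dvd hν h, ncard_filter_pi2_dvd_im hν hfin]
  · obtain ⟨⟨μ, rfl⟩, hμ⟩ := hv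
    have hinj : Function.Injective (algebraMap (Zsqrtd 3) CycInt pi2 * ·) :=
      mul_right_injective₀ prime_algebraMap_pi2.ne_zero
    have hμ' : ¬ pi2 ∣ μ := fun h => hμ (by rw [pow_succ]; exact mul_dvd_mul_left _ h)
    rw [gaussFiber_pi2_sq_mul, Set.ncard_image_of_injective _ hinj]
    rw [normFiber_sq_mul prime_algebraMap_pi2 prime_pi2.ne_zero] at hfin ⊢
    rw [Set.ncard_image_of_injective _ hinj]
    exact ncard_filter_pi2_dvd_im hμ' (hfin.of_finite_image hinj.injOn)

theorem r2_of_four_le {ν : Zsqrtd 3} {v : ℕ} (hv : pi2 ^ v ∣ ν) (h : 4 ≤ v) :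
    r2 ν = (normFiber ν).ncard := by
  obtain ⟨μ, rfl⟩ := (pow_dvd_pow pi2 h).trans hv
  rw [r2_eq, gaussFiber_pi2_pow_four_mul]

theorem p2_isPrime : p2.IsPrime ∧ p2 ≠ ⊥ := span_isPrime prime_pi2

theorem negIdeal_p2 : NegIdeal p2 := negIdeal_span_iff.2 (by rw [pi2_norm]; norm_num)

theorem sup_p2_eq_top {P : Ideal (Zsqrtd 3)} (hP : P.IsPrime) (h0 : P ≠ ⊥) (h : P ≠ p2) :
    P ⊔ p2 = ⊤ :=
  (hP.isMaximal h0).coprime_of_ne (p2_isPrime.1.isMaximal p2_isPrime.2) h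

theorem posPrimes_eq : posPrimes = {P | P.IsPrime ∧ P ≠ ⊥ ∧ PosIdeal P ∧ P ⊔ p2 = ⊤} := by
  ext P
  refine ⟨fun ⟨h1, h2, h3⟩ => ⟨h1, h2, h3, sup_p2_eq_top h1 h2 ?_⟩,
    fun ⟨h1, h2, h3, _⟩ => ⟨h1, h2, h3⟩⟩
  rintro rfl
  exact absurd (posIdeal_span_iff.1 h3) (by rw [pi2_norm]; norm_num)

theorem evenAtNeg_iff (f : Ideal (Zsqrtd 3) → ℕ) : EvenAtNeg f ↔ Even (f p2) ∧
    ∀ Q : Ideal (Zsqrtd 3), Q.IsPrime → Q ≠ ⊥ → NegIdeal Q → Q ⊔ p2 = ⊤ → Even (f Q) := by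
  refine ⟨fun h => ⟨h _ p2_isPrime.1 p2_isPrime.2 negIdeal_p2, fun Q h1 h2 h3 _ => h Q h1 h2 h3⟩,
    fun ⟨h, h'⟩ Q h1 h2 h3 => ?_⟩
  by_cases hQ : Q = p2
  · rwa [hQ]
  · exact h' Q h1 h2 h3 (sup_p2_eq_top h1 h2 hQ)

theorem finprod_posPrimes_pos (f : Ideal (Zsqrtd 3) → ℕ) :
    0 < ∏ᶠ P ∈ posPrimes, (1 + f P : ℤ) :=
  finprod_mem_induction (0 < ·) one_pos (fun _ _ => mul_pos) fun _ _ => by positivity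

/-- Criterion for ν = a + b√3 totally positive to be a sum of two
squares, and the formula for the number of representations.  Here `f P` is the
exponent v_P((ν)) of the nonzero prime ideal P in (ν), characterized by
P^(f P) ∣ (ν) and ¬ P^(f P + 1) ∣ (ν). -/
theorem two_squares_classification (ν : Zsqrtd 3) (hpos : TotPos ν)
    (f : Ideal (Zsqrtd 3) → ℕ)
    (hf : ∀ P : Ideal (Zsqrtd 3), P.IsPrime → P ≠ ⊥ →
      P ^ f P ∣ Ideal.span {ν} ∧ ¬ P ^ (f P + 1) ∣ Ideal.span {ν}) :
    ((∃ x y : Zsqrtd 3, x ^ 2 + y ^ 2 = ν) ↔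
      (Even (f p2) ∧
       (∀ Q : Ideal (Zsqrtd 3), Q.IsPrime → Q ≠ ⊥ → NegIdeal Q → Q ⊔ p2 = ⊤ →
         Even (f Q)) ∧
       (f p2 = 0 → Even ν.im))) ∧
    ((Even (f p2) ∧
      (∀ Q : Ideal (Zsqrtd 3), Q.IsPrime → Q ≠ ⊥ → NegIdeal Q → Q ⊔ p2 = ⊤ →
        Even (f Q)) ∧
      (f p2 = 0 → Even ν.im)) →
      ((f p2 = 0 ∨ f p2 = 2) →
        (r2 ν : ℤ) = 4 * ∏ᶠ P ∈ {P : Ideal (Zsqrtd 3) |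
            P.IsPrime ∧ P ≠ ⊥ ∧ PosIdeal P ∧ P ⊔ p2 = ⊤}, (1 + f P : ℤ)) ∧
      (4 ≤ f p2 →
        (r2 ν : ℤ) = 12 * ∏ᶠ P ∈ {P : Ideal (Zsqrtd 3) |
            P.IsPrime ∧ P ≠ ⊥ ∧ PosIdeal P ∧ P ⊔ p2 = ⊤}, (1 + f P : ℤ))) := by
  rw [← and_assoc, ← evenAtNeg_iff, ← posPrimes_eq]
  obtain ⟨hfin, hempty, hcard⟩ := normFiber_ncard hpos hf
  have hv := IsExponent.span hf prime_pi2
  have hcount : EvenAtNeg f ∧ (f p2 = 0 → Even ν.im) →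
      ((f p2 = 0 ∨ f p2 = 2) → (r2 ν : ℤ) = 4 * ∏ᶠ P ∈ posPrimes, (1 + f P : ℤ)) ∧
      (4 ≤ f p2 → (r2 ν : ℤ) = 12 * ∏ᶠ P ∈ posPrimes, (1 + f P : ℤ)) := by
    rintro ⟨h1, h2⟩
    have hc := hcard h1
    refine ⟨fun h => ?_, fun h => ?_⟩
    · have h3 : 3 * r2 ν = (normFiber ν).ncard := three_mul_r2 hfin hv (h.imp_left fun h => ⟨h, h2 h⟩)
      rw [← h3] at hc
      push_cast at hc
      linarith
    · rw [r2_of_four_le hv.1 h, hc]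
  refine ⟨?_, hcount⟩
  rw [← gaussFiber_nonempty_iff]
  constructor
  · rintro ⟨α, hα⟩
    refine ⟨?_, fun _ => even_im_of_mem_gaussFiber hα⟩
    by_contra h
    have := hα.1
    rw [hempty h] at this
    exact this
  · intro h
    obtain ⟨h4, h12⟩ := hcount h
    have hP := finprod_posPrimes_pos f
    have heven : Even (f p2) := ((evenAtNeg_iff f).1 h.1).1
    have hr : (0 : ℤ) < r2 ν := by
      by_cases h' : 4 ≤ f p2
      · rw [h12 h']; positivity
      · rw [h4 (by obtain ⟨k, hk⟩ := heven; omega)]; positivity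
    rw [r2_eq] at hr
    exact Set.nonempty_of_ncard_ne_zero (by omega)

end Paper3
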